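/- For any two 4×4 positive semidefinite Hermitian complex matrices A and B, the permanents per(A), per(B), per(A∘B) are nonnegative real numbers and per(A)·per(B) ≥ per(A∘B). -/

import Mathlib

open ComplexOrder Matrix

/-- Laplace expansion of the permanent along column `0`. -/
theorem Matrix.permanent_succ_column_zero {R : Type*} [CommRing R] {n : ℕ}
    (M : Matrix (Fin (n + 1)) (Fin (n + 1)) R) :
    M.permanent =
      ∑ i, M i 0 * (M.submatrix (Equiv.swap 0 i ∘ Fin.succ) Fin.succ).permanent := by
  rw [permanent, Finset.univ_perm_fin_succ, ← Finset.univ_product_univ, Finset.sum_map,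
    Finset.sum_product]
  simp [permanent, Finset.mul_sum, Fin.prod_univ_succ]

theorem Matrix.permanent_fin_four {R : Type*} [CommRing R] (M : Matrix (Fin 4) (Fin 4) R) :
    M.permanent =
      M 0 0 * (M 1 1 * (M 2 2 * M 3 3 + M 2 3 * M 3 2) + M 1 2 * (M 2 1 * M 3 3 + M 2 3 * M 3 1)
        + M 1 3 * (M 2 1 * M 3 2 + M 2 2 * M 3 1))
      + M 0 1 * (M 1 0 * (M 2 2 * M 3 3 + M 2 3 * M 3 2) + M 1 2 * (M 2 0 * M 3 3 + M 2 3 * M 3 0)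
        + M 1 3 * (M 2 0 * M 3 2 + M 2 2 * M 3 0))
      + M 0 2 * (M 1 0 * (M 2 1 * M 3 3 + M 2 3 * M 3 1) + M 1 1 * (M 2 0 * M 3 3 + M 2 3 * M 3 0)
        + M 1 3 * (M 2 0 * M 3 1 + M 2 1 * M 3 0))
      + M 0 3 * (M 1 0 * (M 2 1 * M 3 2 + M 2 2 * M 3 1) + M 1 1 * (M 2 0 * M 3 2 + M 2 2 * M 3 0)
        + M 1 2 * (M 2 0 * M 3 1 + M 2 1 * M 3 0)) := by
  simp only [permanent_succ_column_zero, permanent_isEmpty, Fin.sum_univ_succ, submatrix_apply,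
    Function.comp_apply, Finset.univ_eq_empty, Finset.sum_empty]
  simp [Equiv.swap_apply_def, Fin.ext_iff]
  ring

theorem Matrix.permanent_submatrix_self {n R : Type*} [DecidableEq n] [Fintype n] [CommRing R]
    (e : Equiv.Perm n) (M : Matrix n n R) : (M.submatrix e e).permanent = M.permanent := by
  rw [← permanent_permute_rows e M, ← permanent_permute_cols e (M.submatrix id e)]
  rfl

/-- The quadratic form of the Kronecker product of two positive semidefinite matrices. -/
theorem Matrix.PosSemidef.kronecker_sum_nonneg {m n : Type*} [Fintype m] [Fintype n]
    [DecidableEq m] [DecidableEq n] {A : Matrix m m ℂ} {B : Matrix n n ℂ}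
    (hA : A.PosSemidef) (hB : B.PosSemidef) (U : Matrix m n ℂ) :
    0 ≤ ∑ i, ∑ j, star (U i j) * ∑ k, ∑ l, A i k * B j l * U k l := by
  have h := (hA.kronecker hB).dotProduct_mulVec_nonneg fun p => U p.1 p.2
  simpa [dotProduct, mulVec, Fintype.sum_prod_type] using h

/-- The six variables are attached to the edges of the complete graph on four vertices: `a, a'`,
`b, b'` and `c, c'` are the pairs of opposite edges, and `abc'`, `ab'c`, `a'bc`, `a'b'c'` are the
triangles. -/
theorem sum_sq_le_sq_of_pair_bounds_of_triple_bounds {a a' b b' c c' p : ℝ}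
    (ha : 0 ≤ a) (ha' : 0 ≤ a') (hb : 0 ≤ b) (hb' : 0 ≤ b') (hc : 0 ≤ c) (hc' : 0 ≤ c')
    (ha1 : a ≤ 1) (hb1 : b ≤ 1) (hb1' : b' ≤ 1) (hc1 : c ≤ 1) (hc1' : c' ≤ 1)
    (h₁ : (1 + a) * (1 + a') ≤ p) (h₂ : (1 + b) * (1 + b') ≤ p) (h₃ : (1 + c) * (1 + c') ≤ p)
    (t₁ : 2 * (a + b + c') ≤ p) (t₂ : 2 * (a + b' + c) ≤ p)
    (t₃ : 2 * (a' + b + c) ≤ p) (t₄ : 2 * (a' + b' + c') ≤ p) :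
    1 + (a ^ 2 + a' ^ 2 + b ^ 2 + b' ^ 2 + c ^ 2 + c' ^ 2)
      + 2 * (a * b * c' + a * b' * c + a' * b * c + a' * b' * c')
      + (a * a' + b * b' + c * c') ^ 2 ≤ p ^ 2 := by
  have hP : 0 ≤ a * a' + b * b' + c * c' := by positivity
  have hPq : a * a' + b * b' + c * c' ≤ p / 2 := by nlinarith
  rcases le_total 2 p with hp | hp
  · have key {x y z : ℝ} (hx : 0 ≤ x) (hy : 0 ≤ y) (hz : 0 ≤ z) (hy1 : y ≤ 1) (hz1 : z ≤ 1)
        (h : 2 * (x + y + z) ≤ p) : x ^ 2 + y ^ 2 + z ^ 2 + 4 * (x * y * z) ≤ p ^ 2 / 4 := by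
      have : (x + y + z) ^ 2 ≤ (p / 2) ^ 2 := by gcongr; linarith
      linarith [mul_nonneg (mul_nonneg hx hy) (sub_nonneg.2 hz1), mul_nonneg hy hz,
        mul_nonneg (mul_nonneg hx hz) (sub_nonneg.2 hy1)]
    have : (a * a' + b * b' + c * c') ^ 2 ≤ (p / 2) ^ 2 := by gcongr
    linarith [key ha hb hc' hb1 hc1' t₁, key ha hb' hc hb1' hc1 t₂, key ha' hb hc hb1 hc1 t₃,
      key ha' hb' hc' hb1' hc1' t₄, mul_self_le_mul_self zero_le_two hp]
  · have hp0 : 0 ≤ p - 1 := by nlinarith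
    have key {x x' : ℝ} (hx : 0 ≤ x) (hx' : 0 ≤ x') (h : (1 + x) * (1 + x') ≤ p) :
        x + x' ≤ p - 1 := by linarith [mul_nonneg hx hx']
    have u := key ha ha' h₁
    have v := key hb hb' h₂
    have w := key hc hc' h₃
    have half {x x' y y' z z' : ℝ} (hx : 0 ≤ x) (hx' : 0 ≤ x') (hy : 0 ≤ y) (hy' : 0 ≤ y')
        (u : x + x' ≤ p - 1) (v : y + y' ≤ p - 1) (hz : z ≤ 1 / 2) (hz' : z' ≤ 1 / 2) :
        2 * (z' * (x * y + x' * y') + z * (x * y' + x' * y)) ≤ (p - 1) ^ 2 := by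
      have e₁ : (x + x') * (y + y') ≤ (p - 1) * (p - 1) := by gcongr
      have e₂ : z' * (x * y + x' * y') ≤ 1 / 2 * (x * y + x' * y') := by gcongr
      have e₃ : z * (x * y' + x' * y) ≤ 1 / 2 * (x * y' + x' * y) := by gcongr
      linarith
    have hC : 2 * (a * b * c' + a * b' * c + a' * b * c + a' * b' * c') ≤ (p - 1) ^ 2 := by
      by_cases k : a ≤ 1 / 2 ∧ a' ≤ 1 / 2
      · linarith [half hb hb' hc hc' v w k.1 k.2]
      by_cases l : b ≤ 1 / 2 ∧ b' ≤ 1 / 2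
      · linarith [half ha ha' hc hc' u w l.1 l.2]
      by_cases a ≤ 1 / 2 <;> by_cases b ≤ 1 / 2 <;> grind only
    have hQ {x x' : ℝ} (hx : 0 ≤ x) (hx' : 0 ≤ x') (u : x + x' ≤ p - 1) :
        (x + x') ^ 2 ≤ (p - 1) * (x + x') := by nlinarith [mul_nonneg (add_nonneg hx hx') (sub_nonneg.2 u)]
    have hS : 0 ≤ (p - 1) * (2 - (a + a' + b + b' + c + c')) :=
      mul_nonneg hp0 (by linarith)
    have hPP : (a * a' + b * b' + c * c') ^ 2 ≤ a * a' + b * b' + c * c' :=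
      pow_le_of_le_one hP (by linarith) two_ne_zero
    linarith [hQ ha ha' u, hQ hb hb' v, hQ hc hc' w]

section FinFour

variable {A : Matrix (Fin 4) (Fin 4) ℂ}

/-- Lieb's inequality for the block partition `{0, 1} ∪ {2, 3}`. -/
theorem Matrix.PosSemidef.two_two_le_permanent (hA : A.PosSemidef) :
    (A 0 0 * A 1 1 + A 0 1 * A 1 0) * (A 2 2 * A 3 3 + A 2 3 * A 3 2) ≤ A.permanent := by
  have hs (i j) : star (A i j) = A j i := hA.isHermitian.apply j i
  have h₁ := (hA.submatrix ![0, 1]).kronecker_sum_nonneg (hA.submatrix ![2, 3]).transpose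
    !![A 3 1, A 2 1; A 3 0, A 2 0]
  have h₂ := star_mul_self_nonneg (A 0 2 * A 1 3 + A 0 3 * A 1 2)
  simp only [star_add, star_mul, hs] at h₂
  simp only [Fin.sum_univ_two, submatrix_apply, transpose_apply, of_apply, cons_val, hs] at h₁
  rw [← sub_nonneg, permanent_fin_four]
  convert add_nonneg h₁ h₂ using 1
  ring

/-- Lieb's inequality for the block partition `{0, 1, 2} ∪ {3}`. -/
theorem Matrix.PosSemidef.three_one_le_permanent (hA : A.PosSemidef) :
    A 3 3 * 2 * (A 0 0 * (A 1 2 * A 2 1) + A 1 1 * (A 0 2 * A 2 0) + A 2 2 * (A 0 1 * A 1 0))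
      ≤ A.permanent := by
  have hs (i j) : star (A i j) = A j i := hA.isHermitian.apply j i
  have hS := hA.submatrix ![0, 1, 2]
  have h₁ := hS.kronecker_sum_nonneg hS
    !![0, A 3 2, A 3 1; A 3 2, 0, A 3 0; A 3 1, A 3 0, 0]
  have h₂ := mul_nonneg (hA.diag_nonneg (i := 3)) hS.det_nonneg
  rw [det_fin_three] at h₂
  simp only [submatrix_apply, cons_val] at h₂
  simp only [Fin.sum_univ_three, submatrix_apply, of_apply, cons_val, star_zero, hs] at h₁
  rw [← sub_nonneg, permanent_fin_four]
  have h₃ : (0 : ℂ) ≤ 1 / 2 := by norm_num [Complex.le_def]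
  convert add_nonneg (mul_nonneg h₃ h₁) h₂ using 1
  ring

theorem Matrix.PosSemidef.coe_re_diag {n : Type*} {A : Matrix n n ℂ} (hA : A.PosSemidef) (i : n) :
    ((A i i).re : ℂ) = A i i :=
  hA.isHermitian.coe_re_apply_self i

theorem Matrix.PosSemidef.apply_mul_apply_swap {n : Type*} {A : Matrix n n ℂ}
    (hA : A.PosSemidef) (i j : n) : A i j * A j i = ((‖A i j‖ ^ 2 : ℝ) : ℂ) := by
  rw [← hA.isHermitian.apply j i, RCLike.star_def, Complex.mul_conj']
  norm_cast

theorem Matrix.PosSemidef.norm_sq_apply_le {n : Type*} [Fintype n] {A : Matrix n n ℂ}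
    (hA : A.PosSemidef) (i j : n) : ‖A i j‖ ^ 2 ≤ (A i i).re * (A j j).re := by
  have h := (hA.submatrix ![i, j]).det_nonneg
  simp only [det_fin_two, submatrix_apply, cons_val, hA.apply_mul_apply_swap] at h
  rw [← hA.coe_re_diag i, ← hA.coe_re_diag j] at h
  exact sub_nonneg.1 (mod_cast h)

theorem Matrix.PosSemidef.pair_bound (hA : A.PosSemidef) (e : Equiv.Perm (Fin 4)) :
    ((A (e 0) (e 0)).re * (A (e 1) (e 1)).re + ‖A (e 0) (e 1)‖ ^ 2) *
      ((A (e 2) (e 2)).re * (A (e 3) (e 3)).re + ‖A (e 2) (e 3)‖ ^ 2) ≤ A.permanent.re := by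
  have h := (hA.submatrix e).two_two_le_permanent
  simp only [permanent_submatrix_self, submatrix_apply, hA.apply_mul_apply_swap] at h
  rw [← hA.coe_re_diag (e 0), ← hA.coe_re_diag (e 1), ← hA.coe_re_diag (e 2),
    ← hA.coe_re_diag (e 3)] at h
  norm_cast at h
  exact (Complex.le_def.1 h).1

theorem Matrix.PosSemidef.triple_bound (hA : A.PosSemidef) (e : Equiv.Perm (Fin 4)) :
    (A (e 3) (e 3)).re * 2 * ((A (e 0) (e 0)).re * ‖A (e 1) (e 2)‖ ^ 2
      + (A (e 1) (e 1)).re * ‖A (e 0) (e 2)‖ ^ 2 + (A (e 2) (e 2)).re * ‖A (e 0) (e 1)‖ ^ 2)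
      ≤ A.permanent.re := by
  have h := (hA.submatrix e).three_one_le_permanent
  simp only [permanent_submatrix_self, submatrix_apply, hA.apply_mul_apply_swap] at h
  rw [← hA.coe_re_diag (e 0), ← hA.coe_re_diag (e 1), ← hA.coe_re_diag (e 2),
    ← hA.coe_re_diag (e 3)] at h
  norm_cast at h
  exact (Complex.le_def.1 h).1

theorem Matrix.PosSemidef.permanent_nonneg_fin_four (hA : A.PosSemidef) : 0 ≤ A.permanent := by
  have hd (i j) : 0 ≤ A i i * A j j + A i j * A j i := by
    rw [hA.apply_mul_apply_swap]
    exact add_nonneg (mul_nonneg hA.diag_nonneg hA.diag_nonneg) (mod_cast sq_nonneg ‖A i j‖)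
  exact (mul_nonneg (hd 0 1) (hd 2 3)).trans hA.two_two_le_permanent

/-- The case `B = Aᵀ` of Chollet's inequality. -/
theorem Matrix.PosSemidef.sum_norm_sq_le_permanent_sq (hA : A.PosSemidef) :
    ∑ σ : Equiv.Perm (Fin 4), ∏ i, ‖A (σ i) i‖ ^ 2 ≤ A.permanent.re ^ 2 := by
  have hle := hA.norm_sq_apply_le
  have hsymm (i j) : ‖A j i‖ = ‖A i j‖ := by rw [← hA.isHermitian.apply, norm_star]
  have hd (i) : 0 ≤ (A i i).re := (Complex.le_def.1 (hA.diag_nonneg (i := i))).1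
  by_cases h₀ : ∃ i, (A i i).re = 0
  · obtain ⟨i, hi⟩ := h₀
    refine (Finset.sum_eq_zero fun σ _ => ?_).trans_le (sq_nonneg _)
    refine Finset.prod_eq_zero (Finset.mem_univ (σ⁻¹ i)) ?_
    have := hle i (σ⁻¹ i)
    rw [hi, zero_mul] at this
    simpa using le_antisymm this (sq_nonneg _)
  push Not at h₀
  have hN (i j) : ∃ x, 0 ≤ x ∧ x ≤ 1 ∧ ‖A i j‖ ^ 2 = x * ((A i i).re * (A j j).re) := by
    have := mul_ne_zero (h₀ i) (h₀ j)
    exact ⟨‖A i j‖ ^ 2 / ((A i i).re * (A j j).re),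
      div_nonneg (sq_nonneg _) (mul_nonneg (hd i) (hd j)),
      div_le_one_of_le₀ (hle i j) (mul_nonneg (hd i) (hd j)), (div_mul_cancel₀ _ this).symm⟩
  have hdiag (i) : ‖A i i‖ ^ 2 = (A i i).re ^ 2 := by
    rw [← hA.coe_re_diag i, Complex.norm_real, Real.norm_eq_abs, sq_abs, Complex.ofReal_re]
  have hperm := permanent_fin_four (of fun i j => ‖A i j‖ ^ 2)
  simp only [permanent, of_apply] at hperm
  rw [hperm]
  have b₁ := hA.pair_bound 1
  have b₂ := hA.pair_bound (Equiv.swap 1 2)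
  have b₃ := hA.pair_bound (Equiv.swap 1 3)
  have t₁ := hA.triple_bound 1
  have t₂ := hA.triple_bound (Equiv.swap 2 3)
  have t₃ := hA.triple_bound (Equiv.swap 1 3)
  have t₄ := hA.triple_bound (Equiv.swap 0 3)
  simp [Equiv.swap_apply_def] at b₁ b₂ b₃ t₁ t₂ t₃ t₄
  simp only [hdiag, hsymm 0 1, hsymm 0 2, hsymm 0 3, hsymm 1 2, hsymm 1 3, hsymm 2 3]
    at b₁ b₂ b₃ t₁ t₂ t₃ t₄ ⊢
  obtain ⟨a, ha, ha1, ea⟩ := hN 0 1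
  obtain ⟨a', ha', -, ea'⟩ := hN 2 3
  obtain ⟨b, hb, hb1, eb⟩ := hN 0 2
  obtain ⟨b', hb', hb1', eb'⟩ := hN 1 3
  obtain ⟨c, hc, hc1, ec⟩ := hN 0 3
  obtain ⟨c', hc', hc1', ec'⟩ := hN 1 2
  have hD : 0 < (A 0 0).re * (A 1 1).re * (A 2 2).re * (A 3 3).re := by
    have h (i) : 0 < (A i i).re := (hd i).lt_of_ne' (h₀ i)
    exact mul_pos (mul_pos (mul_pos (h 0) (h 1)) (h 2)) (h 3)
  obtain ⟨q, hq⟩ : ∃ q, A.permanent.re = q * ((A 0 0).re * (A 1 1).re * (A 2 2).re * (A 3 3).re) :=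
    ⟨_, (div_mul_cancel₀ _ hD.ne').symm⟩
  rw [hq] at b₁ b₂ b₃ t₁ t₂ t₃ t₄ ⊢
  simp only [ea, ea', eb, eb', ec, ec'] at b₁ b₂ b₃ t₁ t₂ t₃ t₄ ⊢
  have scale {x : ℝ} (h : x * ((A 0 0).re * (A 1 1).re * (A 2 2).re * (A 3 3).re) ≤
      q * ((A 0 0).re * (A 1 1).re * (A 2 2).re * (A 3 3).re)) : x ≤ q := le_of_mul_le_mul_right h hD
  have key := sum_sq_le_sq_of_pair_bounds_of_triple_bounds ha ha' hb hb' hc hc' ha1 hb1 hb1'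
    hc1 hc1' (scale (by linarith)) (scale (by linarith)) (scale (by linarith))
    (scale (by linarith)) (scale (by linarith)) (scale (by linarith)) (scale (by linarith))
  linarith [mul_le_mul_of_nonneg_right key (sq_nonneg
    ((A 0 0).re * (A 1 1).re * (A 2 2).re * (A 3 3).re))]

end FinFour

theorem chollet_4x4 (A B : Matrix (Fin 4) (Fin 4) ℂ)
    (hA : A.PosSemidef) (hB : B.PosSemidef) :
    0 ≤ A.permanent ∧ 0 ≤ B.permanent ∧ 0 ≤ (A ⊙ B).permanent ∧
      (A ⊙ B).permanent ≤ A.permanent * B.permanent := by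
  have hA0 := hA.permanent_nonneg_fin_four
  have hB0 := hB.permanent_nonneg_fin_four
  have hAB0 := (hA.hadamard hB).permanent_nonneg_fin_four
  refine ⟨hA0, hB0, hAB0, ?_⟩
  rw [← Complex.norm_of_nonneg' hAB0, ← Complex.norm_of_nonneg' hA0, ← Complex.norm_of_nonneg' hB0]
  norm_cast
  have hA' := hA.sum_norm_sq_le_permanent_sq
  have hB' := hB.sum_norm_sq_le_permanent_sq
  have hre {z : ℂ} (hz : 0 ≤ z) : z.re = ‖z‖ := by
    conv_lhs => rw [Complex.eq_coe_norm_of_nonneg hz, Complex.ofReal_re]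
  rw [hre hA0] at hA'
  rw [hre hB0] at hB'
  calc ‖(A ⊙ B).permanent‖
      ≤ ∑ σ : Equiv.Perm (Fin 4), (∏ i, ‖A (σ i) i‖) * ∏ i, ‖B (σ i) i‖ := by
        refine (norm_sum_le _ _).trans_eq (Finset.sum_congr rfl fun σ _ => ?_)
        simp [Finset.prod_mul_distrib]
    _ ≤ ‖A.permanent‖ * ‖B.permanent‖ := by
        refine abs_le_of_sq_le_sq' ?_ (by positivity) |>.2
        refine (Finset.sum_mul_sq_le_sq_mul_sq _ _ _).trans ?_
        simp only [← Finset.prod_pow, mul_pow]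
        gcongr
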